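/- Let N, n, p, K be natural numbers with n ≤ p ≤ N, let M be an invertible N×N complex matrix, and let P be an N×p complex matrix such that (i) Pᴴ P = I_p (the columns of P are orthonormal), (ii) for every j < n the j-th column of P is the j-th standard basis vector of ℂ^N, and (iii) for every k with 0 ≤ k ≤ K and every j < n, the j-th column of M^k lies in the column span of P (equivalently P Pᴴ (M^k e_j) = M^k e_j). Then for every l with 1 ≤ l ≤ K+1 and every j < n, the j-th column of the p×p matrix Pᴴ M^l P equals the j-th column of (Pᴴ M P)^l. -/

import Mathlib

open Matrix

/-- If `Q` is a left inverse of `P` and `P * Q` fixes `M ^ k *ᵥ (P *ᵥ u)` for all `k < l`, then the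
`l`-th power of the compression `Q * M * P` acts on `u` as the compression of `M ^ l`. -/
theorem compression_pow_mulVec {R m p : Type*} [Semiring R] [Fintype m] [DecidableEq m]
    [Fintype p] [DecidableEq p] {M : Matrix m m R} {P : Matrix m p R} {Q : Matrix p m R}
    (hQP : Q * P = 1) {u : p → R} {l : ℕ}
    (h : ∀ k < l, (P * Q) *ᵥ (M ^ k *ᵥ (P *ᵥ u)) = M ^ k *ᵥ (P *ᵥ u)) :
    (Q * M * P) ^ l *ᵥ u = (Q * M ^ l * P) *ᵥ u := by
  induction l with
  | zero => simp [hQP]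
  | succ l ih =>
    calc (Q * M * P) ^ (l + 1) *ᵥ u
        = (Q * M * P) *ᵥ ((Q * M * P) ^ l *ᵥ u) := by rw [pow_succ', mulVec_mulVec]
      _ = (Q * M) *ᵥ ((P * Q) *ᵥ (M ^ l *ᵥ (P *ᵥ u))) := by
        rw [ih fun k hk => h k (hk.trans l.lt_succ_self)]
        simp only [mulVec_mulVec, Matrix.mul_assoc]
      _ = (Q * M ^ (l + 1) * P) *ᵥ u := by
        rw [h l l.lt_succ_self, pow_succ']
        simp only [mulVec_mulVec, Matrix.mul_assoc]

/-- **Finite-temperature DMET bath theorem.**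
Let `M` be an invertible `N × N` complex matrix and `P` an `N × p` matrix with
orthonormal columns whose first `n` columns are the first `n` standard basis
vectors of `ℂ^N`, and such that for every `k ≤ K` the first `n` columns of
`M ^ k` lie in the column span of `P` (i.e. `P * Pᴴ` fixes them).  Then for
every `1 ≤ l ≤ K + 1`, the first `n` columns of `Pᴴ * M ^ l * P` agree with
the first `n` columns of `(Pᴴ * M * P) ^ l`. -/
theorem ft_dmet_bath_theorem
    (N n p K : ℕ) (hnp : n ≤ p) (hpN : p ≤ N)
    (M : Matrix (Fin N) (Fin N) ℂ) (hM : IsUnit M)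
    (P : Matrix (Fin N) (Fin p) ℂ)
    (horth : Pᴴ * P = 1)
    (hstd : ∀ j : Fin n, ∀ i : Fin N,
      P i (Fin.castLE hnp j) =
        if i = Fin.castLE (hnp.trans hpN) j then (1 : ℂ) else 0)
    (hspan : ∀ k : ℕ, k ≤ K → ∀ j : Fin n,
      (P * Pᴴ).mulVec ((M ^ k).mulVec (Pi.single (Fin.castLE (hnp.trans hpN) j) 1)) =
        (M ^ k).mulVec (Pi.single (Fin.castLE (hnp.trans hpN) j) 1)) :
    ∀ l : ℕ, 1 ≤ l → l ≤ K + 1 → ∀ j : Fin n, ∀ i : Fin p,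
      (Pᴴ * M ^ l * P) i (Fin.castLE hnp j) =
        ((Pᴴ * M * P) ^ l) i (Fin.castLE hnp j) := by
  intro l _ hl j i
  have hcol : P *ᵥ Pi.single (Fin.castLE hnp j) 1 =
      Pi.single (Fin.castLE (hnp.trans hpN) j) 1 := by
    ext a
    simp [hstd, Pi.single_apply]
  have key := compression_pow_mulVec (M := M) (l := l) (u := Pi.single (Fin.castLE hnp j) 1) horth
    fun k hk => by
      rw [hcol]
      exact hspan k (by lia) j
  simpa using (congrFun key i).symm
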